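/- Hankel's formula: for k > 0 and x > 0, the contour integral Γ(k+1) ∫_{x-i∞}^{x+i∞} e^{uξ}/ξ^{k+1} dξ/(2πi) equals u^k if u ≥ 0 and equals 0 if u < 0. -/

import Mathlib

open MeasureTheory Complex

/-- The density `t ^ k * exp (-x t)` on the half-line, extended by zero. -/
noncomputable def hankelDensity (k x t : ℝ) : ℂ :=
  if 0 ≤ t then ((t ^ k * Real.exp (-(x * t)) : ℝ) : ℂ) else 0

lemma continuous_hankelDensity {k : ℝ} (hk : 0 < k) (x : ℝ) :
    Continuous (hankelDensity k x) := by
  unfold hankelDensity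
  refine Continuous.if_le ?_ continuous_const continuous_const continuous_id ?_
  · exact continuous_ofReal.comp ((Real.continuous_rpow_const hk.le).mul (by fun_prop))
  · rintro t rfl
    simp [Real.zero_rpow hk.ne']

lemma hankelDensity_eq_indicator {k : ℝ} (hk : 0 < k) (x : ℝ) :
    hankelDensity k x =
      (Set.Ioi 0).indicator fun t : ℝ ↦ ((t ^ k * Real.exp (-(x * t)) : ℝ) : ℂ) := by
  ext t
  rcases lt_trichotomy t 0 with h | rfl | h
  · simp [hankelDensity, h.not_ge, h.not_gt]
  · simp [hankelDensity, Real.zero_rpow hk.ne']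
  · simp [hankelDensity, h.le, h]

lemma integrableOn_rpow_mul_exp_neg_mul {k x : ℝ} (hk : -1 < k) (hx : 0 < x) :
    IntegrableOn (fun t : ℝ ↦ t ^ k * Real.exp (-(x * t))) (Set.Ioi 0) := by
  simpa using integrableOn_rpow_mul_exp_neg_mul_rpow hk one_pos hx

lemma integrable_hankelDensity {k x : ℝ} (hk : 0 < k) (hx : 0 < x) :
    Integrable (hankelDensity k x) := by
  rw [hankelDensity_eq_indicator hk, integrable_indicator_iff measurableSet_Ioi]
  exact Integrable.ofReal (integrableOn_rpow_mul_exp_neg_mul (by linarith) hx)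

lemma aestronglyMeasurable_rpow_mul_cexp (k : ℝ) (r : ℂ) (μ : Measure ℝ) :
    AEStronglyMeasurable (fun t : ℝ ↦ ((t ^ k : ℝ) : ℂ) * exp (-(r * t))) μ := by
  refine AEStronglyMeasurable.mul ?_ (Continuous.aestronglyMeasurable (by fun_prop))
  exact (measurable_ofReal.comp (by fun_prop)).aestronglyMeasurable

lemma differentiableAt_integral_rpow_mul_cexp {k : ℝ} (hk : -1 < k) {r : ℂ} (hr : 0 < r.re) :
    DifferentiableAt ℂ
      (fun z : ℂ ↦ ∫ t : ℝ in Set.Ioi 0, ((t ^ k : ℝ) : ℂ) * exp (-(z * t))) r := by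
  have hs : {z : ℂ | r.re / 2 < z.re} ∈ nhds r :=
    (isOpen_lt continuous_const continuous_re).mem_nhds (by simpa using hr)
  refine (hasDerivAt_integral_of_dominated_loc_of_deriv_le
    (F' := fun z t ↦ ((t ^ k : ℝ) : ℂ) * exp (-(z * t)) * (-t))
    (bound := fun t ↦ t ^ (k + 1) * Real.exp (-(r.re / 2 * t))) hs
    (.of_forall fun z ↦ aestronglyMeasurable_rpow_mul_cexp k z _) ?_ ?_ ?_
    (integrableOn_rpow_mul_exp_neg_mul (by linarith) (by linarith)) ?_).2.differentiableAt
  · refine (integrableOn_rpow_mul_exp_neg_mul hk hr).mono'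
      (aestronglyMeasurable_rpow_mul_cexp k r _) ?_
    filter_upwards [ae_restrict_mem measurableSet_Ioi] with t ht
    have ht' : 0 < t := ht
    simp [norm_exp, abs_of_pos (Real.rpow_pos_of_pos ht' k)]
  · exact (aestronglyMeasurable_rpow_mul_cexp k r _).mul
      (Continuous.aestronglyMeasurable (by fun_prop))
  · filter_upwards [ae_restrict_mem measurableSet_Ioi] with t ht z hz
    have ht' : 0 < t := ht
    have hz' : r.re / 2 < z.re := hz
    rw [norm_mul, norm_mul, norm_neg, norm_real, norm_real, norm_exp, Real.rpow_add_one ht'.ne',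
      Real.norm_of_nonneg (Real.rpow_nonneg ht'.le k), Real.norm_of_nonneg ht'.le, mul_right_comm]
    gcongr
    simpa using mul_le_mul_of_nonneg_right hz'.le ht'.le
  · refine .of_forall fun t z _ ↦ ?_
    have h : HasDerivAt (fun z : ℂ ↦ -(z * t)) (-t : ℂ) z := by
      simpa [Function.comp_def] using ((hasDerivAt_id z).mul_const (t : ℂ)).fun_neg
    simpa [mul_assoc] using h.cexp.const_mul ((t ^ k : ℝ) : ℂ)

/-- Laplace transform of `t ^ k` at a complex point of the right half-plane. -/
lemma integral_rpow_mul_cexp_neg_mul_Ioi {k : ℝ} (hk : -1 < k) {r : ℂ} (hr : 0 < r.re) :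
    ∫ t : ℝ in Set.Ioi 0, ((t ^ k : ℝ) : ℂ) * exp (-(r * t)) =
      (Real.Gamma (k + 1) : ℂ) * (1 / r ^ ((k : ℂ) + 1)) := by
  have hopen : IsOpen {z : ℂ | 0 < z.re} := isOpen_lt continuous_const continuous_re
  have hexp : (k : ℂ) + 1 ≠ 0 := fun h ↦ by
    have := congrArg re h
    simp at this
    linarith
  have hL : AnalyticOnNhd ℂ
      (fun z : ℂ ↦ ∫ t : ℝ in Set.Ioi 0, ((t ^ k : ℝ) : ℂ) * exp (-(z * t))) {z | 0 < z.re} :=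
    DifferentiableOn.analyticOnNhd (fun z hz ↦
      (differentiableAt_integral_rpow_mul_cexp hk hz).differentiableWithinAt) hopen
  have hR : AnalyticOnNhd ℂ
      (fun z : ℂ ↦ (Real.Gamma (k + 1) : ℂ) * (1 / z ^ ((k : ℂ) + 1))) {z | 0 < z.re} := by
    refine DifferentiableOn.analyticOnNhd (fun z hz ↦ ?_) hopen
    have hz' : z ∈ slitPlane := Or.inl hz
    exact (((differentiableAt_const 1).div (differentiableAt_id.cpow_const hz')
      ((cpow_ne_zero_iff_of_exponent_ne_zero hexp).2
        (slitPlane_ne_zero hz'))).const_mul _).differentiableWithinAt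
  refine hL.eqOn_of_preconnected_of_frequently_eq hR
    (convex_halfSpace_re_gt 0).isPreconnected (z₀ := 1) (by simp) ?_ hr
  have htend : Filter.Tendsto ofReal (nhdsWithin 1 (Set.Ioi 1)) (nhdsWithin 1 {1}ᶜ) := by
    refine tendsto_nhdsWithin_iff.2 ⟨?_, ?_⟩
    · simpa using (continuous_ofReal.tendsto (1 : ℝ)).mono_left nhdsWithin_le_nhds
    · filter_upwards [self_mem_nhdsWithin] with t ht
      simpa using (show 1 < t from ht).ne'
  refine htend.frequently (Filter.Eventually.frequently ?_)
  filter_upwards [self_mem_nhdsWithin] with y hy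
  have hy' : 0 < y := one_pos.trans hy
  have h := Real.integral_rpow_mul_exp_neg_mul_Ioi (a := k + 1) (by linarith) hy'
  rw [add_sub_cancel_right, one_div, Real.inv_rpow hy'.le, mul_comm] at h
  have h' := congrArg ofReal h
  rw [← integral_complex_ofReal] at h'
  push_cast [ofReal_cpow hy'.le] at h'
  simpa using h'

lemma fourier_hankelDensity {k x : ℝ} (hk : 0 < k) (hx : 0 < x) (w : ℝ) :
    FourierTransform.fourier (hankelDensity k x) w =
      (Real.Gamma (k + 1) : ℂ) * (1 / (x + (2 * Real.pi * w : ℝ) * I) ^ ((k : ℂ) + 1)) := by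
  rw [← integral_rpow_mul_cexp_neg_mul_Ioi (by linarith) (by simpa using hx),
    Real.fourier_real_eq_integral_exp_smul, hankelDensity_eq_indicator hk,
    ← integral_indicator measurableSet_Ioi]
  congr 1
  ext t
  by_cases ht : t ∈ Set.Ioi (0 : ℝ)
  · simp only [Set.indicator_of_mem ht, smul_eq_mul]
    rw [ofReal_mul (t ^ k), ofReal_exp, mul_left_comm, ← Complex.exp_add]
    congr 2
    push_cast
    ring
  · simp [Set.indicator_of_notMem ht]

lemma integrable_one_div_vertical_cpow {k x : ℝ} (hk : 0 < k) (hx : 0 < x) :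
    Integrable fun y : ℝ ↦ 1 / ((x : ℂ) + y * I) ^ ((k : ℂ) + 1) := by
  have hc : 0 < min x 1 / 2 := by positivity
  have hcont : Continuous fun y : ℝ ↦ 1 / ((x : ℂ) + y * I) ^ ((k : ℂ) + 1) := by
    have hs : ∀ y : ℝ, (x : ℂ) + y * I ∈ slitPlane := fun y ↦ Or.inl (by simpa using hx)
    refine continuous_const.div (Continuous.cpow (by fun_prop) continuous_const hs) fun y ↦ ?_
    exact (cpow_ne_zero_iff_of_exponent_ne_zero (by
      intro h; have := congrArg re h; simp at this; linarith)).2 (slitPlane_ne_zero (hs y))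
  have hb := (integrable_one_add_norm (E := ℝ) (μ := volume) (r := k + 1)
    (by simpa using hk)).const_mul ((min x 1 / 2) ^ (-(k + 1)))
  refine hb.mono' hcont.aestronglyMeasurable (.of_forall fun y ↦ ?_)
  have h1 : min x 1 / 2 * (1 + ‖y‖) ≤ ‖(x : ℂ) + y * I‖ := by
    have hre := Complex.abs_re_le_norm ((x : ℂ) + y * I)
    have him := Complex.abs_im_le_norm ((x : ℂ) + y * I)
    simp [abs_of_pos hx] at hre him
    rw [Real.norm_eq_abs]
    nlinarith [min_le_left x 1, min_le_right x 1, abs_nonneg y]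
  have hpos : 0 < min x 1 / 2 * (1 + ‖y‖) := by positivity
  have hcast : (k : ℂ) + 1 = ((k + 1 : ℝ) : ℂ) := by push_cast; rfl
  rw [norm_div, norm_one, hcast, norm_cpow_real, one_div, ← Real.rpow_neg (norm_nonneg _),
    ← Real.mul_rpow hc.le (by positivity)]
  exact Real.rpow_le_rpow_of_nonpos hpos h1 (by linarith)

theorem stmt_3 (k x u : ℝ) (hk : 0 < k) (hx : 0 < x) :
    (Real.Gamma (k + 1) : ℂ) *
        ((1 / (2 * Real.pi)) *
          ∫ y : ℝ, Complex.exp (u * (x + y * I)) / (x + y * I) ^ ((k : ℂ) + 1)) =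
      if 0 ≤ u then ((u ^ k : ℝ) : ℂ) else 0 := by
  have hF : FourierTransform.fourier (hankelDensity k x) = fun w : ℝ ↦
      (Real.Gamma (k + 1) : ℂ) * (1 / (x + (2 * Real.pi * w : ℝ) * I) ^ ((k : ℂ) + 1)) :=
    funext (fourier_hankelDensity hk hx)
  have hFint : Integrable (FourierTransform.fourier (hankelDensity k x)) := by
    rw [hF]
    exact ((integrable_one_div_vertical_cpow hk hx).comp_mul_left'
      (by positivity : 2 * Real.pi ≠ 0)).const_mul _
  have hinv := congrFun ((continuous_hankelDensity hk x).fourierInv_fourier_eq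
    (integrable_hankelDensity hk hx) hFint) u
  rw [hF, Real.fourierInv_eq'] at hinv
  set g : ℝ → ℂ := fun y ↦ exp (u * (x + y * I)) / (x + y * I) ^ ((k : ℂ) + 1) with hg
  have hscale := Measure.integral_comp_mul_left g (2 * Real.pi)
  rw [abs_of_pos (by positivity), Complex.real_smul] at hscale
  have hint : ∫ w : ℝ, g (2 * Real.pi * w) =
      (1 / (2 * Real.pi)) * ∫ y : ℝ, g y := by
    rw [hscale]; push_cast; rw [one_div]
  rw [← hint, ← integral_const_mul]
  have hexp : (fun w : ℝ ↦ (Real.Gamma (k + 1) : ℂ) * g (2 * Real.pi * w)) = fun w : ℝ ↦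
      exp (u * x) * (exp (↑(2 * Real.pi * inner ℝ w u) * I) • ((Real.Gamma (k + 1) : ℂ) *
        (1 / (x + (2 * Real.pi * w : ℝ) * I) ^ ((k : ℂ) + 1)))) := by
    ext w
    have he : exp ((u : ℂ) * (x + (2 * Real.pi * w : ℝ) * I)) =
        exp (u * x) * exp (↑(2 * Real.pi * inner ℝ w u) * I) := by
      rw [← Complex.exp_add]
      congr 1
      simp
      ring
    simp only [hg, he, smul_eq_mul]
    ring
  rw [hexp, integral_const_mul, hinv]
  unfold hankelDensity
  split_ifs
  · push_cast
    rw [mul_left_comm, ← Complex.exp_add]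
    simp [mul_comm]
  · simp
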